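/- Fix integers m ≥ 2, n ≥ 4, and 1 ≤ h ≤ n − 3. There exists a constant C > 0 such that for every finite field F with q elements (where, if m > 2, the characteristic of F is assumed greater than n), | (1/q^n) · Σ_{f ∈ M_n(F)} ( Σ_{g ∈ F[x], deg g ≤ h} (Λ(f + g) − 1) )^m | ≤ C·q^{(h+1)(m−1)}. -/

import Mathlib

open scoped Classical

/-- The von Mangoldt function for polynomials over a field: `Λ f = deg g` if `f = g ^ k` for
some irreducible `g` and some `k ≥ 1`, and `Λ f = 0` otherwise. (For `f` a prime power, the
degree of the irreducible `g` is independent of the choice of witness.) -/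
noncomputable def polyVonMangoldt {F : Type*} [Field F] (f : Polynomial F) : ℕ :=
  if h : ∃ g : Polynomial F, Irreducible g ∧ ∃ k : ℕ, 1 ≤ k ∧ f = g ^ k
  then h.choose.natDegree else 0

/-- The monic polynomial `X ^ n + ∑_{j < n} c j * X ^ j`; as `c` ranges over `Fin n → F`
this enumerates the monic polynomials of degree `n` exactly once. -/
noncomputable def monicOfCoeffs {F : Type*} [Field F] (n : ℕ) (c : Fin n → F) : Polynomial F :=
  Polynomial.X ^ n + ∑ j : Fin n, Polynomial.C (c j) * Polynomial.X ^ (j : ℕ)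

/-- If the power sums of `s` are `O(B ^ k)`, then every element of `s` has norm at most `B`. -/
lemma norm_le_of_forall_norm_powerSum_le {s : Multiset ℂ} {B C : ℝ} {k₀ : ℕ} (hB : 0 < B)
    (h : ∀ k ≥ k₀, ‖(s.map fun b => b ^ k).sum‖ ≤ C * B ^ k) {β : ℂ} (hβ : β ∈ s) :
    ‖β‖ ≤ B := by
  set g : Polynomial ℂ := ∏ b ∈ s.toFinset.erase β, (Polynomial.X - Polynomial.C b) with hg
  have hgβ : g.eval β ≠ 0 := by
    rw [hg, Polynomial.eval_prod, Finset.prod_ne_zero_iff]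
    intro b hb
    simpa [sub_eq_zero] using (Finset.ne_of_mem_erase hb).symm
  have hg0 : ∀ b ∈ s, b ≠ β → g.eval b = 0 := by
    intro b hb hne
    rw [hg, Polynomial.eval_prod]
    exact Finset.prod_eq_zero (Finset.mem_erase.2 ⟨hne, by simpa using hb⟩) (by simp)
  have hsum : ∀ k, (s.map fun b => g.eval b * b ^ k).sum = s.count β * (g.eval β * β ^ k) := by
    intro k
    rw [Finset.sum_multiset_map_count, Finset.sum_eq_single β]
    · simp
    · intro b hb hne
      rw [hg0 b (by simpa using hb) hne]; simp
    · intro hn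
      exact absurd (by simpa using hβ) hn
  have hsum' : ∀ k, (s.map fun b => g.eval b * b ^ k).sum =
      ∑ t ∈ Finset.range (g.natDegree + 1), g.coeff t * (s.map fun b => b ^ (k + t)).sum := by
    intro k
    simp_rw [← Multiset.sum_map_mul_left]
    refine Eq.trans ?_ (Multiset.sum_map_sum_map s (Finset.range (g.natDegree + 1)).val)
    congr 1
    refine Multiset.map_congr rfl fun b _ => ?_
    change _ = ∑ t ∈ Finset.range (g.natDegree + 1), g.coeff t * b ^ (k + t)
    rw [Polynomial.eval_eq_sum_range, Finset.sum_mul]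
    exact Finset.sum_congr rfl fun t _ => by ring
  set C' := ∑ t ∈ Finset.range (g.natDegree + 1), ‖g.coeff t‖ * (C * B ^ t) with hC'
  have hbound : ∀ k ≥ k₀, s.count β * (‖g.eval β‖ * ‖β‖ ^ k) ≤ C' * B ^ k := by
    intro k hk
    calc (s.count β : ℝ) * (‖g.eval β‖ * ‖β‖ ^ k) = ‖(s.count β : ℂ) * (g.eval β * β ^ k)‖ := by
          simp
      _ ≤ _ := by
          rw [← hsum, hsum', hC', Finset.sum_mul]
          refine (norm_sum_le _ _).trans (Finset.sum_le_sum fun t _ => ?_)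
          rw [norm_mul, mul_assoc]
          refine mul_le_mul_of_nonneg_left ((h _ (by omega)).trans_eq ?_) (norm_nonneg _)
          ring
  by_contra! hlt
  have hc : 0 < (s.count β : ℝ) * ‖g.eval β‖ :=
    mul_pos (by exact_mod_cast Multiset.count_pos.2 hβ) (norm_pos_iff.2 hgβ)
  obtain ⟨k, hk, hk'⟩ := ((tendsto_pow_atTop_atTop_of_one_lt ((one_lt_div hB).2 hlt)).eventually_gt_atTop
    (C' / (s.count β * ‖g.eval β‖))).and (Filter.eventually_ge_atTop k₀) |>.exists
  rw [div_pow, div_lt_div_iff₀ hc (by positivity)] at hk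
  have := hbound k hk'
  nlinarith

/-- The degree of the `l`-th coefficient of `∏ i < K, (1 - Y ^ q ^ i * T)`. -/
def coeffDegree (q K l : ℕ) : ℕ := ∑ t ∈ Finset.range l, q ^ (K - 1 - t)

lemma coeffDegree_add (q K D : ℕ) {l : ℕ} (hl : l ≤ D) :
    coeffDegree q (K + D) l = q ^ K * coeffDegree q D l := by
  rw [coeffDegree, coeffDegree, Finset.mul_sum]
  refine Finset.sum_congr rfl fun t ht => ?_
  rw [← pow_add]
  congr 1
  have := Finset.mem_range.1 ht
  omega

lemma coeffDegree_le {q K l D : ℕ} (hq : 0 < q) (hl : l ≤ D) :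
    coeffDegree q K l ≤ D * q ^ (K - 1) := by
  calc coeffDegree q K l ≤ ∑ t ∈ Finset.range l, q ^ (K - 1) :=
        Finset.sum_le_sum fun t _ => Nat.pow_le_pow_right hq (by omega)
    _ ≤ _ := by simpa using Nat.mul_le_mul_right _ hl

lemma coeffDegree_succ_self (q D : ℕ) :
    coeffDegree q (D + 1) (D + 1) = q * coeffDegree q D D + 1 := by
  rw [coeffDegree, Finset.sum_range_succ, ← coeffDegree, add_comm D 1,
    coeffDegree_add q 1 D le_rfl]
  simp

lemma digits_injective {q : ℕ} : ∀ (D : ℕ) {j j' : ℕ} {e e' : Fin D → ℕ},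
    (∀ l, e l < q) → (∀ l, e' l < q) →
    j * q ^ D + ∑ l : Fin D, e l * coeffDegree q D (l + 1) =
      j' * q ^ D + ∑ l : Fin D, e' l * coeffDegree q D (l + 1) → j = j' ∧ e = e'
  | 0, j, j', e, e', _, _, h => ⟨by simpa using h, Subsingleton.elim _ _⟩
  | D + 1, j, j', e, e', he, he', h => by
    have key : ∀ (j : ℕ) (e : Fin (D + 1) → ℕ),
        j * q ^ (D + 1) + ∑ l : Fin (D + 1), e l * coeffDegree q (D + 1) (l + 1) =
          q * (j * q ^ D + ∑ l : Fin D, e l.castSucc * coeffDegree q D (l + 1) +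
            e (Fin.last D) * coeffDegree q D D) + e (Fin.last D) := by
      intro j e
      have : ∀ l : Fin D, coeffDegree q (D + 1) (l + 1) = q * coeffDegree q D (l + 1) := by
        intro l
        rw [add_comm D 1, coeffDegree_add q 1 D l.2, pow_one]
      rw [Fin.sum_univ_castSucc]
      simp only [Fin.val_castSucc, Fin.val_last, this, coeffDegree_succ_self, mul_add,
        Finset.mul_sum]
      simp only [mul_left_comm _ q]
      ring
    rw [key, key] at h
    have hlast : e (Fin.last D) = e' (Fin.last D) := by
      have := congrArg (· % q) h
      simpa [Nat.mul_add_mod, Nat.mod_eq_of_lt (he _), Nat.mod_eq_of_lt (he' _)] using this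
    have hq : 0 < q := (Nat.zero_le _).trans_lt (he 0)
    rw [hlast] at h
    have h2 := Nat.eq_of_mul_eq_mul_left hq (Nat.add_right_cancel h)
    obtain ⟨hj, hee⟩ := digits_injective D (fun l => he l.castSucc) (fun l => he' l.castSucc)
      (Nat.add_right_cancel h2)
    refine ⟨hj, funext fun l => ?_⟩
    induction l using Fin.lastCases with
    | last => exact hlast
    | cast l => exact congrFun hee l

section FrobeniusProduct

variable {F : Type*} [Field F]

/-- The power series `∏ i < K, (1 - Y ^ q ^ i * T)` in `T` over `F[Y]`. -/
noncomputable def frobProd (F : Type*) [Field F] (q K : ℕ) : PowerSeries (Polynomial F) :=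
  ∏ i ∈ Finset.range K,
    (1 - PowerSeries.C ((Polynomial.X : Polynomial F) ^ q ^ i) * PowerSeries.X)

/-- The inverse of `frobProd F q K`, as a product of geometric series. -/
noncomputable def frobProdInv (F : Type*) [Field F] (q K : ℕ) : PowerSeries (Polynomial F) :=
  ∏ i ∈ Finset.range K, PowerSeries.mk fun m => ((Polynomial.X : Polynomial F) ^ q ^ i) ^ m

lemma one_sub_mul_mk_pow {R : Type*} [CommRing R] (a : R) :
    (1 - PowerSeries.C a * PowerSeries.X) * PowerSeries.mk (fun m => a ^ m) = 1 := by
  ext n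
  rw [sub_mul, one_mul, mul_assoc]
  cases n with
  | zero => simp
  | succ n => simp [PowerSeries.coeff_succ_X_mul, pow_succ', PowerSeries.coeff_one]

lemma frobProd_mul_inv (q K : ℕ) : frobProd F q K * frobProdInv F q K = 1 := by
  rw [frobProd, frobProdInv, ← Finset.prod_mul_distrib]
  exact Finset.prod_eq_one fun i _ => one_sub_mul_mk_pow _

lemma coeff_frobProd {q : ℕ} (hq : 2 ≤ q) (K : ℕ) : ∀ l,
    (K < l → PowerSeries.coeff l (frobProd F q K) = 0) ∧
    (l ≤ K → PowerSeries.coeff l (frobProd F q K) ≠ 0 ∧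
      (PowerSeries.coeff l (frobProd F q K)).natDegree = coeffDegree q K l) := by
  induction K with
  | zero =>
    intro l
    constructor
    · intro hl
      simp [frobProd, PowerSeries.coeff_one, hl.ne']
    · intro hl
      obtain rfl : l = 0 := by omega
      simp [frobProd, coeffDegree]
  | succ K ih =>
    have hrec0 : PowerSeries.coeff 0 (frobProd F q (K + 1)) =
        PowerSeries.coeff 0 (frobProd F q K) := by
      rw [frobProd, Finset.prod_range_succ, ← frobProd, mul_sub, mul_one]
      simp
    have hrec : ∀ l, PowerSeries.coeff (l + 1) (frobProd F q (K + 1)) =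
        PowerSeries.coeff (l + 1) (frobProd F q K) -
          PowerSeries.coeff l (frobProd F q K) * Polynomial.X ^ q ^ K := by
      intro l
      rw [frobProd, Finset.prod_range_succ, ← frobProd, mul_sub, mul_one, map_sub, ← mul_assoc,
        PowerSeries.coeff_succ_mul_X, PowerSeries.coeff_mul_C]
    rintro (_ | l)
    · refine ⟨fun h => absurd h (by omega), fun _ => ?_⟩
      rw [hrec0]
      simpa [coeffDegree] using (ih 0).2 (Nat.zero_le _)
    · refine ⟨fun h => ?_, fun h => ?_⟩
      · rw [hrec, (ih (l + 1)).1 (by omega), (ih l).1 (by omega)]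
        simp
      · have hl := (ih l).2 (by omega)
        have hdeg : (PowerSeries.coeff l (frobProd F q K) *
            (Polynomial.X : Polynomial F) ^ q ^ K).natDegree = coeffDegree q (K + 1) (l + 1) := by
          rw [Polynomial.natDegree_mul hl.1 (pow_ne_zero _ Polynomial.X_ne_zero), hl.2,
            Polynomial.natDegree_X_pow, coeffDegree, coeffDegree, Finset.sum_range_succ']
          refine congrArg₂ _ (Finset.sum_congr rfl fun t _ => ?_) (by simp)
          congr 1
          omega
        have hlt : (PowerSeries.coeff (l + 1) (frobProd F q K)).natDegree <
            (PowerSeries.coeff l (frobProd F q K) *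
              (Polynomial.X : Polynomial F) ^ q ^ K).natDegree := by
          rw [hdeg]
          rcases Nat.lt_or_ge K (l + 1) with h' | h'
          · rw [(ih (l + 1)).1 h', coeffDegree, Finset.sum_range_succ]
            simp only [Polynomial.natDegree_zero]
            have : 0 < q ^ (K + 1 - 1 - l) := by positivity
            omega
          · rw [((ih (l + 1)).2 h').2, coeffDegree, coeffDegree]
            rw [Finset.sum_range_succ, Finset.sum_range_succ']
            refine add_lt_add_of_le_of_lt (Finset.sum_le_sum fun t _ => ?_) ?_
            · exact Nat.pow_le_pow_right (by omega) (by omega)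
            · exact Nat.pow_lt_pow_right (by omega) (by omega)
        rw [hrec]
        have h2 := Polynomial.natDegree_sub_eq_right_of_natDegree_lt hlt
        refine ⟨fun h0 => ?_, h2.trans hdeg⟩
        rw [h0] at h2
        rw [← h2] at hlt
        simp at hlt

/-- Coefficients of bounded slope are preserved by products of power series. -/
lemma natDegree_coeff_mul_le {B : ℕ} {f g : PowerSeries (Polynomial F)}
    (hf : ∀ l, (PowerSeries.coeff l f).natDegree ≤ l * B)
    (hg : ∀ l, (PowerSeries.coeff l g).natDegree ≤ l * B) (l : ℕ) :
    (PowerSeries.coeff l (f * g)).natDegree ≤ l * B := by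
  rw [PowerSeries.coeff_mul]
  refine Polynomial.natDegree_sum_le_of_forall_le _ _ fun x hx => ?_
  refine Polynomial.natDegree_mul_le.trans ((add_le_add (hf _) (hg _)).trans_eq ?_)
  rw [← add_mul, Finset.HasAntidiagonal.mem_antidiagonal.1 hx]

lemma natDegree_coeff_frobProdInv_le {q : ℕ} (hq : 0 < q) (K l : ℕ) :
    (PowerSeries.coeff l (frobProdInv F q K)).natDegree ≤ l * q ^ (K - 1) := by
  rw [frobProdInv]
  refine Finset.prod_induction (M := PowerSeries (Polynomial F)) _
    (fun f => ∀ l, (PowerSeries.coeff l f).natDegree ≤ l * q ^ (K - 1))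
    (fun f g hf hg => natDegree_coeff_mul_le hf hg) (fun l => ?_) (fun i hi l => ?_) l
  · rw [PowerSeries.coeff_one]; split_ifs <;> simp
  · have := Finset.mem_range.1 hi
    rw [PowerSeries.coeff_mk, ← pow_mul, Polynomial.natDegree_X_pow, mul_comm]
    exact Nat.mul_le_mul_left _ (Nat.pow_le_pow_right hq (by omega))

end FrobeniusProduct

section Orbit

variable {F : Type*} [Field F]

lemma reverse_map {E : Type*} [Field E] (φ : F →+* E) (f : Polynomial F) :
    (f.map φ).reverse = f.reverse.map φ := by
  rw [Polynomial.reverse, Polynomial.natDegree_map, Polynomial.reflect_map, Polynomial.reverse]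

lemma coe_reverse_prod_X_sub_C (b : ℕ → F) (k : ℕ) :
    ((∏ i ∈ Finset.range k, (Polynomial.X - Polynomial.C (b i))).reverse : PowerSeries F) =
      ∏ i ∈ Finset.range k, (1 - PowerSeries.C (b i) * PowerSeries.X) := by
  induction k with
  | zero =>
    have : (1 : Polynomial F).reverse = 1 := Polynomial.reverse_C 1
    simp [this]
  | succ k ih =>
    have h : (Polynomial.X - Polynomial.C (b k)).reverse = 1 - Polynomial.C (b k) * Polynomial.X := by
      ext n
      rw [Polynomial.coeff_reverse, Polynomial.natDegree_X_sub_C]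
      rcases n with _ | _ | n
      · simp
      · simp [Polynomial.coeff_one]
      · rw [Polynomial.revAt_eq_self_of_lt (by omega)]
        simp [Polynomial.coeff_X, Polynomial.coeff_one]
    rw [Finset.prod_range_succ, Finset.prod_range_succ, Polynomial.reverse_mul_of_domain,
      Polynomial.coe_mul, ih, h]
    simp

variable [Fintype F] {P : Polynomial F}

local notation "q" => Fintype.card F

lemma root_pow_and_map_eq_prod (hP : P.Monic) (hPi : Irreducible P) :
    AdjoinRoot.root P ^ q ^ P.natDegree = AdjoinRoot.root P ∧
      P.map (AdjoinRoot.of P) = ∏ i ∈ Finset.range P.natDegree,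
        (Polynomial.X - Polynomial.C (AdjoinRoot.root P ^ q ^ i)) := by
  have : Fact (Irreducible P) := ⟨hPi⟩
  have : Module.Finite F (AdjoinRoot P) := hP.finite_adjoinRoot
  have : Finite (AdjoinRoot P) := Module.finite_of_finite F
  have hfr : Module.finrank F (AdjoinRoot P) = P.natDegree := by
    rw [(AdjoinRoot.powerBasis hP.ne_zero).finrank, AdjoinRoot.powerBasis_dim]
  have hord := FiniteField.orderOf_frobeniusAlgHom F (AdjoinRoot P)
  set φ := FiniteField.frobeniusAlgHom F (AdjoinRoot P) with hφ
  have hφpow : ∀ (i : ℕ) x, (φ ^ i) x = x ^ q ^ i := by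
    intro i x
    rw [AlgHom.coe_pow, hφ, FiniteField.coe_frobeniusAlgHom, pow_iterate]
  rw [hfr] at hord
  constructor
  · rw [← hφpow, ← hord, pow_orderOf_eq_one]
    rfl
  · refine Polynomial.eq_of_monic_of_dvd_of_natDegree_le
      (Polynomial.monic_prod_of_monic _ _ fun i _ => Polynomial.monic_X_sub_C _) (hP.map _) ?_ ?_
    · refine Finset.prod_dvd_of_coprime (fun i hi j hj hij => ?_) fun i _ => ?_
      · refine Polynomial.isCoprime_X_sub_C_of_isUnit_sub (IsUnit.mk0 _ (sub_ne_zero.2 fun h => ?_))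
        rw [← hφpow, ← hφpow] at h
        have h2 : φ ^ i = φ ^ j := AdjoinRoot.algHom_ext h
        exact hij (pow_injOn_Iio_orderOf (by simpa [hord] using hi) (by simpa [hord] using hj) h2)
      · rw [Polynomial.dvd_iff_isRoot, Polynomial.IsRoot, Polynomial.eval_map, ← hφpow,
          ← AdjoinRoot.algebraMap_eq, ← Polynomial.aeval_def, Polynomial.aeval_algHom_apply,
          AdjoinRoot.aeval_eq, AdjoinRoot.mk_self, map_zero]
    · rw [Polynomial.natDegree_map, Polynomial.natDegree_prod_of_monic _ _ fun i _ =>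
        Polynomial.monic_X_sub_C _]
      simp only [Polynomial.natDegree_X_sub_C]
      simp

lemma root_pow_and_map_pow_eq_prod (hP : P.Monic) (hPi : Irreducible P) (j : ℕ) :
    AdjoinRoot.root P ^ q ^ (P.natDegree * j) = AdjoinRoot.root P ∧
      (P ^ j).map (AdjoinRoot.of P) = ∏ i ∈ Finset.range (P.natDegree * j),
        (Polynomial.X - Polynomial.C (AdjoinRoot.root P ^ q ^ i)) := by
  obtain ⟨h1, h2⟩ := root_pow_and_map_eq_prod hP hPi
  induction j with
  | zero => simp
  | succ j ih =>
    refine ⟨by rw [mul_add, pow_add, pow_mul, ih.1, mul_one, h1], ?_⟩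
    rw [pow_succ, Polynomial.map_mul, ih.2, h2, mul_add, mul_one, Finset.prod_range_add]
    simp_rw [pow_add, pow_mul _ (q ^ (P.natDegree * j)), ih.1]

lemma map_frobProd {E : Type*} [Field E] [Algebra F E] (a : E) (K : ℕ) :
    PowerSeries.map (Polynomial.aeval a : Polynomial F →ₐ[F] E).toRingHom (frobProd F q K) =
      ∏ i ∈ Finset.range K, (1 - PowerSeries.C (a ^ q ^ i) * PowerSeries.X) := by
  rw [frobProd, map_prod]
  simp

/-- At a root `a` of a prime whose `j`-th power has degree `2 * K` and prescribed top
coefficients, `frobProd` at `a` is determined by its inverse at `a ^ q ^ K`. -/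
lemma aeval_coeff_frobProd (hP : P.Monic) (hPi : Irreducible P) {j K D : ℕ}
    (hj : P.natDegree * j = 2 * K) {p : Polynomial F}
    (hp : ∀ l ≤ D, (P ^ j).reverse.coeff l = p.coeff l) {l : ℕ} (hl : l ≤ D) :
    Polynomial.aeval (AdjoinRoot.root P) (PowerSeries.coeff l (frobProd F q K)) =
      Polynomial.aeval (AdjoinRoot.root P ^ q ^ K) (PowerSeries.coeff l
        (PowerSeries.map Polynomial.C (p : PowerSeries F) * frobProdInv F q K)) := by
  have : Fact (Irreducible P) := ⟨hPi⟩
  obtain ⟨h1, h2⟩ := root_pow_and_map_pow_eq_prod hP hPi j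
  set a := AdjoinRoot.root P
  let ev (b : AdjoinRoot P) : PowerSeries (Polynomial F) →+* PowerSeries (AdjoinRoot P) :=
    PowerSeries.map (Polynomial.aeval b : Polynomial F →ₐ[F] AdjoinRoot P).toRingHom
  have hinv : ev (a ^ q ^ K) (frobProd F q K) * ev (a ^ q ^ K) (frobProdInv F q K) = 1 := by
    rw [← map_mul, frobProd_mul_inv, map_one]
  have hprod : ev a (frobProd F q K) * ev (a ^ q ^ K) (frobProd F q K) =
      PowerSeries.map (AdjoinRoot.of P) ((P ^ j).reverse : PowerSeries F) := by
    rw [← Polynomial.polynomial_map_coe, ← reverse_map, h2, coe_reverse_prod_X_sub_C, hj,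
      two_mul, Finset.prod_range_add]
    simp only [ev]
    rw [map_frobProd, map_frobProd]
    simp_rw [pow_add, pow_mul]
  have hG : ev a (frobProd F q K) = PowerSeries.map (AdjoinRoot.of P)
      ((P ^ j).reverse : PowerSeries F) * ev (a ^ q ^ K) (frobProdInv F q K) := by
    rw [← hprod, mul_assoc, hinv, mul_one]
  have hcoeff : ∀ (b : AdjoinRoot P) (f : PowerSeries (Polynomial F)),
      Polynomial.aeval b (PowerSeries.coeff l f) = PowerSeries.coeff l (ev b f) :=
    fun b f => (PowerSeries.coeff_map _ _ _).symm
  have hC : ev (a ^ q ^ K) (PowerSeries.map Polynomial.C (p : PowerSeries F)) =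
      PowerSeries.map (AdjoinRoot.of P) (p : PowerSeries F) := by
    ext n
    simp [ev, AdjoinRoot.algebraMap_eq]
  rw [hcoeff, hcoeff, hG, (ev (a ^ q ^ K)).map_mul, hC, PowerSeries.coeff_mul, PowerSeries.coeff_mul]
  refine Finset.sum_congr rfl fun x hx => ?_
  have := Finset.HasAntidiagonal.mem_antidiagonal.1 hx
  simp only [PowerSeries.coeff_map, Polynomial.coeff_coe]
  rw [hp _ (by omega)]

end Orbit

/-- Linear combinations of nonzero polynomials of distinct degrees do not vanish. -/
lemma sum_C_mul_ne_zero {F ι : Type*} [Field F] [Fintype ι] {v : ι → Polynomial F} (hv : ∀ x, v x ≠ 0)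
    (hinj : Function.Injective fun x => (v x).natDegree) {c : ι → F} {x₀ : ι} (hc : c x₀ ≠ 0) :
    ∑ x, Polynomial.C (c x) * v x ≠ 0 := by
  have hdeg : ∀ x, c x ≠ 0 → (Polynomial.C (c x) * v x).degree = (v x).natDegree := by
    intro x hx
    rw [Polynomial.degree_C_mul hx, Polynomial.degree_eq_natDegree (hv x)]
  have h := Polynomial.degree_sum_eq_of_disjoint (fun x => Polynomial.C (c x) * v x) Finset.univ
    (fun x hx y hy hxy => by
      have hx' : c x ≠ 0 := fun h => hx.2 (by simp [h])
      have hy' : c y ≠ 0 := fun h => hy.2 (by simp [h])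
      simp only [Function.onFun, Function.comp, hdeg x hx', hdeg y hy', ne_eq, Nat.cast_inj]
      exact fun h => hxy (hinj h))
  intro h0
  rw [h0, Polynomial.degree_zero] at h
  have h1 := Finset.le_sup (f := fun x => (Polynomial.C (c x) * v x).degree) (Finset.mem_univ x₀)
  rw [← h] at h1
  simp only [hdeg x₀ hc] at h1
  simp at h1

section Stepanov

variable {F : Type*} [Field F] [Fintype F]

local notation "q" => Fintype.card F

/-- The auxiliary polynomial of Stepanov's method: of small degree, and vanishing at all points
`a` of the extension of degree `2 * K` whose norm to the truncated one-units is prescribed. -/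
lemma exists_auxiliary_polynomial {K D : ℕ} (hDK : D ≤ K) (hK : D ^ 2 + 2 ≤ q ^ K)
    (p : Polynomial F) :
    ∃ s : Polynomial F, s ≠ 0 ∧ s.natDegree ≤ q ^ (2 * K - D) + (2 * D ^ 2 + 3) * q ^ K ∧
      ∀ (E : Type _) [Field E] [Algebra F E] (a : E), a ^ q ^ (2 * K) = a →
        (∀ l ≤ D, Polynomial.aeval a (PowerSeries.coeff l (frobProd F q K)) =
          Polynomial.aeval (a ^ q ^ K) (PowerSeries.coeff l
            (PowerSeries.map Polynomial.C (p : PowerSeries F) * frobProdInv F q K))) →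
        Polynomial.aeval a s = 0 := by
  have hq : 2 ≤ q := Fintype.one_lt_card
  have hq0 : 0 < q := by omega
  set r := q ^ K with hr
  set A := q ^ (K - D) with hA
  set B := A + D ^ 2 + 2 with hB
  have hAr : A * q ^ D = r := by rw [hA, hr, ← pow_add]; congr 1; omega
  have hA0 : 0 < A := by positivity
  have hr0 : 0 < r := by positivity
  have hAle : A ≤ r := hAr ▸ Nat.le_mul_of_pos_right _ (by positivity)
  have hrA : r * A = q ^ (2 * K - D) := by rw [hA, hr, ← pow_add]; congr 1; omega
  let G (l : Fin D) := PowerSeries.coeff (l + 1 : ℕ) (frobProd F q K)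
  let Z (l : Fin D) := PowerSeries.coeff (l + 1 : ℕ)
    (PowerSeries.map Polynomial.C (p : PowerSeries F) * frobProdInv F q K)
  have hG : ∀ l, G l ≠ 0 ∧ (G l).natDegree = coeffDegree q K (l + 1) :=
    fun l => (coeff_frobProd hq K _).2 (by omega)
  have hslope : D * (q * (D * q ^ (K - 1))) ≤ D ^ 2 * r := by
    rcases Nat.eq_zero_or_pos D with h | h
    · simp [h]
    · have : q * q ^ (K - 1) = r := by rw [← pow_succ']; congr 1; omega
      rw [← this]
      apply le_of_eq
      ring
  have hZ : ∀ l, (Z l).natDegree ≤ D * q ^ (K - 1) := by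
    intro l
    refine (natDegree_coeff_mul_le (B := q ^ (K - 1)) (fun l => ?_)
      (natDegree_coeff_frobProdInv_le hq0 K) _).trans (Nat.mul_le_mul_right _ l.2)
    simp
  let ι := Fin A × Fin B × (Fin D → Fin q)
  let v (x : ι) : Polynomial F := Polynomial.X ^ (x.1 : ℕ) *
    Polynomial.X ^ (r * x.2.1 : ℕ) * ∏ l, G l ^ (x.2.2 l : ℕ)
  let w (x : ι) : Polynomial F := Polynomial.X ^ (r * x.1 : ℕ) *
    Polynomial.X ^ (x.2.1 : ℕ) * ∏ l, Z l ^ (x.2.2 l : ℕ)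
  have hv0 : ∀ x, v x ≠ 0 := fun x => mul_ne_zero (mul_ne_zero
    (pow_ne_zero _ Polynomial.X_ne_zero) (pow_ne_zero _ Polynomial.X_ne_zero))
    (Finset.prod_ne_zero_iff.2 fun l _ => pow_ne_zero _ (hG l).1)
  have hvdeg : ∀ x, (v x).natDegree =
      x.1 + r * x.2.1 + ∑ l, (x.2.2 l : ℕ) * coeffDegree q K (l + 1) := by
    intro x
    simp only [v]
    rw [Polynomial.natDegree_mul (mul_ne_zero (pow_ne_zero _ Polynomial.X_ne_zero)
      (pow_ne_zero _ Polynomial.X_ne_zero)) (Finset.prod_ne_zero_iff.2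
        fun l _ => pow_ne_zero _ (hG l).1), Polynomial.natDegree_prod _ _
        fun l _ => pow_ne_zero _ (hG l).1, ← pow_add, Polynomial.natDegree_X_pow]
    simp only [Polynomial.natDegree_pow, (hG _).2]
  have hvinj : Function.Injective fun x => (v x).natDegree := by
    have key : ∀ x, (v x).natDegree = A * ((x.2.1 : ℕ) * q ^ D +
        ∑ l : Fin D, (x.2.2 l : ℕ) * coeffDegree q D (l + 1)) + x.1 := by
      intro x
      have hK' : K = K - D + D := by omega
      have : ∀ l : Fin D, coeffDegree q K (l + 1) = A * coeffDegree q D (l + 1) := by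
        intro l
        conv_lhs => rw [hK']
        exact coeffDegree_add q (K - D) D l.2
      simp only [hvdeg, this, ← hAr, mul_add, Finset.mul_sum]
      simp only [mul_left_comm _ A]
      ring
    intro x y hxy
    simp only [key] at hxy
    have h1 : x.1 = y.1 := by
      have := congrArg (· % A) hxy
      simp only [Nat.mul_add_mod, Nat.mod_eq_of_lt (Fin.is_lt _)] at this
      exact Fin.ext this
    rw [h1] at hxy
    obtain ⟨h2, h3⟩ := digits_injective D (fun l => (x.2.2 l).2) (fun l => (y.2.2 l).2)
      (Nat.eq_of_mul_eq_mul_left hA0 (Nat.add_right_cancel hxy))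
    exact Prod.ext h1 (Prod.ext (Fin.ext h2) (funext fun l => Fin.ext (congrFun h3 l)))
  set N := r * (A - 1) + B + D ^ 2 * r with hN
  have hwdeg : ∀ x, w x ∈ Polynomial.degreeLT F N := by
    intro x
    rw [Polynomial.mem_degreeLT]
    refine (Polynomial.degree_le_natDegree).trans_lt (Nat.cast_lt.2 ?_)
    have h1 : (∏ l, Z l ^ (x.2.2 l : ℕ)).natDegree ≤ D ^ 2 * r := by
      refine (Polynomial.natDegree_prod_le _ _).trans (le_trans ?_ hslope)
      refine (Finset.sum_le_card_nsmul _ _ (q * (D * q ^ (K - 1))) fun l _ => ?_).trans (by simp)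
      exact Polynomial.natDegree_pow_le.trans (Nat.mul_le_mul (x.2.2 l).2.le (hZ l))
    have h2 : r * (x.1 : ℕ) ≤ r * (A - 1) := Nat.mul_le_mul_left _ (by have := x.1.2; omega)
    have h3 := x.2.1.2
    refine Polynomial.natDegree_mul_le.trans_lt ?_
    rw [← pow_add, Polynomial.natDegree_X_pow]
    omega
  have hcard : N < Fintype.card ι := by
    simp only [ι, Fintype.card_prod, Fintype.card_fin, Fintype.card_fun]
    rw [mul_left_comm, hAr, hN]
    have h1 : r * (A - 1) + r = r * A := by
      rw [← Nat.mul_succ]; congr 1; omega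
    have h2 : B * r = r * A + D ^ 2 * r + 2 * r := by rw [hB]; ring
    linarith
  have hdep : ¬ LinearIndependent F fun x => (⟨w x, hwdeg x⟩ : Polynomial.degreeLT F N) := by
    intro h
    have := h.fintype_card_le_finrank
    rw [(Polynomial.degreeLTEquiv F N).finrank_eq, Module.finrank_fin_fun] at this
    omega
  obtain ⟨c, hc, x₀, hx₀⟩ := Fintype.not_linearIndependent_iff.1 hdep
  have hc' : ∑ x, Polynomial.C (c x) * w x = 0 := by
    have := congrArg Subtype.val hc
    simpa [Polynomial.smul_eq_C_mul] using this
  refine ⟨∑ x, Polynomial.C (c x) * v x, sum_C_mul_ne_zero hv0 hvinj hx₀, ?_, ?_⟩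
  · refine Polynomial.natDegree_sum_le_of_forall_le _ _ fun x _ => ?_
    refine (Polynomial.natDegree_C_mul_le _ _).trans ?_
    rw [hvdeg, ← hrA]
    have h1 : ∑ l, (x.2.2 l : ℕ) * coeffDegree q K (l + 1) ≤ D ^ 2 * r := by
      refine le_trans ?_ hslope
      refine (Finset.sum_le_card_nsmul _ _ (q * (D * q ^ (K - 1))) fun l _ => ?_).trans (by simp)
      exact Nat.mul_le_mul (x.2.2 l).2.le (coeffDegree_le hq0 l.2)
    have h2 : r * (x.2.1 : ℕ) ≤ r * B := Nat.mul_le_mul_left _ x.2.1.2.le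
    have h3 := x.1.2
    have h4 : r * B = r * A + D ^ 2 * r + 2 * r := by rw [hB]; ring
    linarith
  · intro E _ _ a ha hrel
    have ha' : (a ^ r) ^ r = a := by rw [← pow_mul, hr, ← pow_add, ← two_mul, ha]
    have := congrArg (Polynomial.aeval (a ^ r)) hc'
    rw [map_zero] at this
    rw [← this]
    simp only [map_sum, map_mul, map_pow, map_prod, Polynomial.aeval_X, Polynomial.aeval_C, v, w, G,
      Z]
    refine Finset.sum_congr rfl fun x _ => ?_
    rw [pow_mul (a ^ r) r, ha', pow_mul a r]
    congr 2
    exact Finset.prod_congr rfl fun l _ => by rw [hrel _ l.2]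

/-- Stepanov's upper bound for prime powers of degree `2 * K` with prescribed top coefficients. -/
lemma sum_natDegree_le {K D : ℕ} (hDK : D ≤ K) (hK : D ^ 2 + 2 ≤ q ^ K) (p : Polynomial F)
    (S : Finset (Polynomial F)) (hS : ∀ P ∈ S, P.Monic ∧ Irreducible P ∧
      ∃ j, P.natDegree * j = 2 * K ∧ ∀ l ≤ D, (P ^ j).reverse.coeff l = p.coeff l) :
    ∑ P ∈ S, P.natDegree ≤ q ^ (2 * K - D) + (2 * D ^ 2 + 3) * q ^ K := by
  obtain ⟨s, hs0, hsdeg, hs⟩ := exists_auxiliary_polynomial hDK hK p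
  refine le_trans ?_ hsdeg
  rw [← Polynomial.natDegree_prod_of_monic _ _ fun P hP => (hS P hP).1]
  refine Polynomial.natDegree_le_of_dvd ?_ hs0
  refine Finset.prod_dvd_of_coprime (fun P hP Q hQ hPQ => ?_) fun P hP => ?_
  · obtain ⟨hPm, hPi, -⟩ := hS P hP
    obtain ⟨hQm, hQi, -⟩ := hS Q hQ
    refine (EuclideanDomain.dvd_or_coprime P Q hPi).resolve_left fun h => hPQ ?_
    exact Polynomial.eq_of_monic_of_associated hPm hQm ((hPi.dvd_irreducible_iff_associated hQi).1 h)
  · obtain ⟨hPm, hPi, j, hj, hp⟩ := hS P hP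
    have : Fact (Irreducible P) := ⟨hPi⟩
    rw [← AdjoinRoot.mk_eq_zero, ← AdjoinRoot.aeval_eq]
    refine hs _ _ ?_ fun l hl => aeval_coeff_frobProd hPm hPi hj hp hl
    rw [← hj]
    exact (root_pow_and_map_pow_eq_prod hPm hPi j).1

end Stepanov

section VonMangoldt

open Polynomial UniqueFactorizationMonoid

variable {F : Type*} [Field F]

lemma polyVonMangoldt_pow {P : F[X]} (hP : Irreducible P) {k : ℕ} (hk : 1 ≤ k) :
    polyVonMangoldt (P ^ k) = P.natDegree := by
  have h : ∃ g : F[X], Irreducible g ∧ ∃ l : ℕ, 1 ≤ l ∧ P ^ k = g ^ l := ⟨P, hP, k, hk, rfl⟩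
  rw [polyVonMangoldt, dif_pos h]
  obtain ⟨hg, l, hl, he⟩ := h.choose_spec
  have : Associated h.choose P := by
    refine hg.associated_of_dvd hP ((hg.prime.dvd_of_dvd_pow (n := k)) ?_)
    exact (dvd_pow_self _ (by omega)).trans he.symm.dvd
  exact natDegree_eq_of_degree_eq (degree_eq_degree_of_associated this)

lemma exists_eq_pow_of_polyVonMangoldt_ne_zero {f : F[X]} (hf : f.Monic)
    (h : polyVonMangoldt f ≠ 0) :
    ∃ P : F[X], P.Monic ∧ Irreducible P ∧ ∃ k, 1 ≤ k ∧ f = P ^ k := by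
  rw [polyVonMangoldt] at h
  split_ifs at h with h'
  · obtain ⟨g, hg, k, hk, rfl⟩ := h'
    refine ⟨normalize g, monic_normalize hg.ne_zero, (normalize_associated g).symm.irreducible hg, k,
      hk, ?_⟩
    conv_lhs => rw [← hf.normalize_eq_self]
    exact map_pow normalizeHom g k
  · exact absurd rfl h

lemma polyVonMangoldt_le_natDegree (f : F[X]) : polyVonMangoldt f ≤ f.natDegree := by
  by_cases h : ∃ g : F[X], Irreducible g ∧ ∃ k : ℕ, 1 ≤ k ∧ f = g ^ k
  · obtain ⟨g, hg, k, hk, rfl⟩ := h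
    rw [polyVonMangoldt_pow hg hk, natDegree_pow]
    exact Nat.le_mul_of_pos_left _ hk
  · rw [polyVonMangoldt, dif_neg h]
    exact Nat.zero_le _

lemma polyVonMangoldt_one : polyVonMangoldt (1 : F[X]) = 0 := by
  simpa using polyVonMangoldt_le_natDegree (1 : F[X])

lemma degree_sum_C_mul_X_pow_lt {k : ℕ} (c : Fin k → F) :
    (∑ j : Fin k, C (c j) * X ^ (j : ℕ)).degree < (k : WithBot ℕ) := by
  rw [← mem_degreeLT]
  refine Submodule.sum_mem _ fun j _ => ?_
  rw [mem_degreeLT]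
  exact (degree_C_mul_X_pow_le _ _).trans_lt (by exact_mod_cast j.2)

lemma coeff_sum_C_mul_X_pow {k : ℕ} (c : Fin k → F) (l : ℕ) :
    (∑ j : Fin k, C (c j) * X ^ (j : ℕ)).coeff l = if h : l < k then c ⟨l, h⟩ else 0 := by
  simp only [finsetSum_coeff, coeff_C_mul, coeff_X_pow]
  split_ifs with h
  · rw [Finset.sum_eq_single ⟨l, h⟩]
    · simp
    · intro j _ hj
      rw [if_neg (fun e => hj (Fin.ext e.symm)), mul_zero]
    · simp
  · refine Finset.sum_eq_zero fun j _ => ?_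
    rw [if_neg (by have := j.2; omega), mul_zero]

lemma monicOfCoeffs_injective (k : ℕ) : Function.Injective (monicOfCoeffs (F := F) k) := by
  intro c d h
  ext j
  have := congrArg (fun f => f.coeff (j : ℕ)) (add_left_cancel h)
  simpa only [coeff_sum_C_mul_X_pow, dif_pos j.2] using this

variable [Fintype F]

/-- The monic polynomials of degree `k`. -/
noncomputable def monicFinset (F : Type*) [Field F] [Fintype F] (k : ℕ) : Finset F[X] :=
  Finset.univ.image (monicOfCoeffs k)

lemma mem_monicFinset {k : ℕ} {f : F[X]} : f ∈ monicFinset F k ↔ f.Monic ∧ f.natDegree = k := by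
  simp only [monicFinset, Finset.mem_image, Finset.mem_univ, true_and]
  constructor
  · rintro ⟨c, rfl⟩
    have h := degree_sum_C_mul_X_pow_lt c
    refine ⟨monic_X_pow_add h, ?_⟩
    rw [monicOfCoeffs, natDegree_add_eq_left_of_degree_lt (by simpa using h), natDegree_X_pow]
  · rintro ⟨hf, rfl⟩
    refine ⟨fun j => f.coeff j, ?_⟩
    rw [monicOfCoeffs, Fin.sum_univ_eq_sum_range (fun j => C (f.coeff j) * X ^ j)]
    exact hf.as_sum.symm

lemma card_monicFinset (k : ℕ) : (monicFinset F k).card = Fintype.card F ^ k := by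
  rw [monicFinset, Finset.card_image_of_injective _ (monicOfCoeffs_injective k)]
  simp

lemma sum_monicFinset {M : Type*} [AddCommMonoid M] (k : ℕ) (G : F[X] → M) :
    ∑ f ∈ monicFinset F k, G f = ∑ c : Fin k → F, G (monicOfCoeffs k c) :=
  Finset.sum_image fun _ _ _ _ h => monicOfCoeffs_injective k h

lemma monicFinset_zero : monicFinset F 0 = {1} := by
  ext f
  rw [mem_monicFinset, Finset.mem_singleton]
  exact ⟨fun h => h.1.natDegree_eq_zero.1 h.2, fun h => by simp [h]⟩

/-- `∑_{g ∣ f} Λ g = deg f`, written as a sum over factorizations of `f`. -/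
lemma sum_polyVonMangoldt_factorizations {k : ℕ} {f : F[X]} (hf : f ∈ monicFinset F k) :
    ∑ x ∈ ((Finset.HasAntidiagonal.antidiagonal k).sigma
        fun p => monicFinset F p.1 ×ˢ monicFinset F p.2).filter fun x => x.2.1 * x.2.2 = f,
      polyVonMangoldt x.2.1 = k := by
  obtain ⟨hfm, hfk⟩ := mem_monicFinset.1 hf
  have hf0 := hfm.ne_zero
  have hmon : ∀ P ∈ normalizedFactors f, P.Monic ∧ Irreducible P := fun P hP => by
    have hi := irreducible_of_normalized_factor P hP
    refine ⟨?_, hi⟩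
    rw [← normalize_normalized_factor P hP]
    exact monic_normalize hi.ne_zero
  have hdeg : k = ∑ P ∈ (normalizedFactors f).toFinset,
      (normalizedFactors f).count P * P.natDegree := by
    have h1 := prod_normalizedFactors_eq hf0
    rw [hfm.normalize_eq_self] at h1
    have h2 := natDegree_multiset_prod_of_monic (normalizedFactors f) fun P hP => (hmon P hP).1
    rw [h1, hfk] at h2
    rw [h2, Finset.sum_multiset_map_count]
    simp
  have hdvd : ∀ P ∈ normalizedFactors f, ∀ i, i ≤ (normalizedFactors f).count P ↔ P ^ i ∣ f := by
    intro P hP i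
    rw [pow_dvd_iff_le_emultiplicity,
      emultiplicity_eq_count_normalizedFactors (hmon P hP).2 hf0, (hmon P hP).1.normalize_eq_self]
    simp
  conv_rhs => rw [hdeg]
  have h3 : ∀ P ∈ (normalizedFactors f).toFinset,
      (normalizedFactors f).count P * P.natDegree =
        ∑ _i ∈ Finset.Icc 1 ((normalizedFactors f).count P), P.natDegree := fun P _ => by simp
  rw [Finset.sum_congr rfl h3, Finset.sum_sigma']
  symm
  refine Finset.sum_of_injOn (fun y => ⟨(y.2 * y.1.natDegree, k - y.2 * y.1.natDegree),
    (y.1 ^ y.2, f / y.1 ^ y.2)⟩) ?_ ?_ ?_ ?_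
  · rintro ⟨P, i⟩ hP ⟨Q, j⟩ hQ h
    simp only [Finset.coe_sigma, Set.mem_sigma_iff, Finset.mem_coe, Multiset.mem_toFinset,
      Finset.mem_Icc] at hP hQ
    simp only [Sigma.mk.injEq, Prod.mk.injEq] at h
    obtain ⟨⟨h1, -⟩, h2⟩ := h
    have h3 : P ^ i = Q ^ j := by
      have := h2
      rw [heq_eq_eq, Prod.mk.injEq] at this
      exact this.1
    have h4 : P = Q := by
      refine eq_of_monic_of_associated (hmon P hP.1).1 (hmon Q hQ.1).1
        ((hmon P hP.1).2.associated_of_dvd (hmon Q hQ.1).2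
          ((hmon P hP.1).2.prime.dvd_of_dvd_pow (n := j) ?_))
      rw [← h3]
      exact dvd_pow_self _ (by omega)
    subst h4
    have := Nat.eq_of_mul_eq_mul_right (hmon P hP.1).2.natDegree_pos h1
    rw [this]
  · rintro ⟨P, i⟩ hP
    simp only [Finset.coe_sigma, Set.mem_sigma_iff, Finset.mem_coe, Multiset.mem_toFinset,
      Finset.mem_Icc] at hP
    obtain ⟨hPf, h1, hi⟩ := hP
    obtain ⟨e, he⟩ := (hdvd P hPf i).1 hi
    have hPm := (hmon P hPf).1.pow i
    have hem : e.Monic := hPm.of_mul_monic_left (he ▸ hfm)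
    have hd := hPm.natDegree_mul hem
    rw [← he, hfk, natDegree_pow] at hd
    have hdiv : f / P ^ i = e := by
      rw [he]; exact mul_div_cancel_left₀ _ hPm.ne_zero
    simp only [Finset.coe_filter, Set.mem_ofPred_eq, Finset.mem_sigma,
      Finset.HasAntidiagonal.mem_antidiagonal, Finset.mem_product, mem_monicFinset, hdiv, ← he,
      natDegree_pow, and_true]
    exact ⟨by omega, hPm, hem, by omega⟩
  · rintro ⟨⟨a, b⟩, g, e⟩ hx hne
    simp only [Finset.mem_filter, Finset.mem_sigma,
      Finset.HasAntidiagonal.mem_antidiagonal, Finset.mem_product, mem_monicFinset] at hx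
    obtain ⟨⟨hab, ⟨hg, hga⟩, he, heb⟩, hge⟩ := hx
    by_contra h0
    obtain ⟨P, hPm, hPi, i, hi, rfl⟩ := exists_eq_pow_of_polyVonMangoldt_ne_zero hg h0
    have hPf : P ∈ normalizedFactors f := by
      have : P ∣ f := by
        rw [← hge]; exact (dvd_pow_self P (by omega)).mul_right e
      exact (mem_normalizedFactors_iff' hf0).2 ⟨hPi, hPm.normalize_eq_self, this⟩
    refine hne ⟨⟨P, i⟩, ?_, ?_⟩
    · simp only [Finset.coe_sigma, Set.mem_sigma_iff, Finset.mem_coe, Multiset.mem_toFinset,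
        Finset.mem_Icc]
      exact ⟨hPf, hi, (hdvd P hPf i).2 (hge ▸ dvd_mul_right _ _)⟩
    · have hdiv : f / P ^ i = e := by
        rw [← hge]; exact mul_div_cancel_left₀ _ hg.ne_zero
      rw [natDegree_pow] at hga
      simp only [hdiv, hga]
      congr 2
      omega
  · rintro ⟨P, i⟩ hP
    simp only [Finset.mem_sigma, Multiset.mem_toFinset, Finset.mem_Icc] at hP
    exact (polyVonMangoldt_pow (hmon P hP.1).2 hP.2.1).symm

/-- The convolution identity `k A_k = ∑_{i + j = k} Ψ_i A_j`. -/
lemma mul_sum_eq_sum_antidiagonal {R : Type*} [CommSemiring R] (ψ : F[X] →* R) (k : ℕ) :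
    k * ∑ f ∈ monicFinset F k, ψ f = ∑ p ∈ Finset.HasAntidiagonal.antidiagonal k,
      (∑ f ∈ monicFinset F p.1, polyVonMangoldt f * ψ f) * ∑ f ∈ monicFinset F p.2, ψ f := by
  simp_rw [Finset.sum_mul_sum, ← Finset.sum_product']
  rw [Finset.sum_sigma', Finset.mul_sum]
  refine Eq.trans ?_ (Finset.sum_fiberwise_of_maps_to (t := monicFinset F k)
    (g := fun x => x.2.1 * x.2.2) ?_ _)
  · refine Finset.sum_congr rfl fun f hf => ?_
    conv_lhs => rw [← sum_polyVonMangoldt_factorizations hf]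
    rw [Nat.cast_sum, Finset.sum_mul]
    refine Finset.sum_congr rfl fun x hx => ?_
    rw [← (Finset.mem_filter.1 hx).2, map_mul, mul_assoc]
  · rintro ⟨⟨a, b⟩, g, e⟩ hx
    simp only [Finset.mem_sigma,
      Finset.HasAntidiagonal.mem_antidiagonal, Finset.mem_product, mem_monicFinset] at hx
    obtain ⟨hab, ⟨hg, hga⟩, he, heb⟩ := hx
    exact mem_monicFinset.2 ⟨hg.mul he, by rw [hg.natDegree_mul he]; omega⟩

/-- The prime polynomial theorem. -/
lemma sum_polyVonMangoldt {k : ℕ} (hk : 1 ≤ k) :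
    ∑ f ∈ monicFinset F k, polyVonMangoldt f = Fintype.card F ^ k := by
  induction k using Nat.strong_induction_on with
  | _ k ih =>
  obtain ⟨k, rfl⟩ : ∃ l, k = l + 1 := ⟨k - 1, by omega⟩
  have h := mul_sum_eq_sum_antidiagonal (1 : F[X] →* ℕ) (k + 1)
  simp only [MonoidHom.one_apply, mul_one, Finset.sum_const, card_monicFinset, smul_eq_mul,
    Nat.cast_id] at h
  rw [Finset.Nat.sum_antidiagonal_succ', Finset.Nat.sum_antidiagonal_eq_sum_range_succ_mk,
    Finset.sum_range_succ'] at h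
  simp only [pow_zero, mul_one, monicFinset_zero, Finset.sum_singleton, polyVonMangoldt_one,
    zero_mul, add_zero] at h
  have h2 : ∀ i ∈ Finset.range k, (∑ f ∈ monicFinset F (i + 1), polyVonMangoldt f) *
      Fintype.card F ^ (k - (i + 1) + 1) = Fintype.card F ^ (k + 1) := by
    intro i hi
    rw [Finset.mem_range] at hi
    rw [ih (i + 1) (by omega) (by omega), ← pow_add]
    congr 1
    omega
  rw [Finset.sum_congr rfl h2] at h
  simp only [Finset.sum_const, Finset.card_range, smul_eq_mul] at h
  linarith

end VonMangoldt

section PowerSums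

open Polynomial

lemma exists_multiset_eq_prod {K : Type*} [Field K] [IsAlgClosed K] {L : K[X]} (hL : L.coeff 0 = 1) :
    ∃ s : Multiset K, Multiset.card s ≤ L.natDegree ∧ L = (s.map fun b => 1 - C b * X).prod := by
  have hL0 : L ≠ 0 := fun h => by simp [h] at hL
  refine ⟨L.roots.map (·⁻¹), by simpa using card_roots' L, ?_⟩
  have h := (IsAlgClosed.splits L).eq_prod_roots
  have h1 : L.roots.map (fun b => X - C b) = L.roots.map fun b => C (-b) * (1 - C b⁻¹ * X) := by
    refine Multiset.map_congr rfl fun b hb => ?_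
    have hb0 : b ≠ 0 := by
      rintro rfl
      rw [mem_roots hL0, IsRoot, ← coeff_zero_eq_eval_zero, hL] at hb
      exact one_ne_zero hb
    rw [mul_sub, ← mul_assoc, ← C_mul, neg_mul, mul_inv_cancel₀ hb0]
    simp only [map_neg, map_one]
    ring
  have hC : (L.roots.map fun b => C (-b)).prod = C (L.roots.map fun b => -b).prod := by
    rw [map_multiset_prod, Multiset.map_map]
    rfl
  rw [h1, Multiset.prod_map_mul, ← mul_assoc, hC, ← C_mul] at h
  have h2 := congrArg (fun f => eval 0 f) h
  simp only [eval_mul, eval_C, eval_multiset_prod, Multiset.map_map, ← coeff_zero_eq_eval_zero L,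
    hL] at h2
  simp at h2
  rw [Multiset.prod_map_neg, ← h2] at h
  simpa [Function.comp_def, Multiset.map_map] using h

lemma X_mul_derivative_prod {K : Type*} [Field K] (s : Multiset K) :
    PowerSeries.X * PowerSeries.derivative K
      (s.map fun b => 1 - PowerSeries.C b * PowerSeries.X).prod =
    (PowerSeries.mk fun k => if k = 0 then 0 else -(s.map fun b => b ^ k).sum) *
      (s.map fun b => 1 - PowerSeries.C b * PowerSeries.X).prod := by
  induction s using Multiset.induction_on with
  | empty =>
    have : (PowerSeries.mk fun k =>
        if k = 0 then (0 : K) else -((0 : Multiset K).map fun b => b ^ k).sum) = 0 := by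
      ext k; simp
    rw [this]
    simp
  | cons b s ih =>
    have h : (PowerSeries.mk fun k => if k = 0 then 0 else -((b ::ₘ s).map fun b => b ^ k).sum) =
        (PowerSeries.mk fun k => if k = 0 then 0 else -(s.map fun b => b ^ k).sum) -
          PowerSeries.mk fun k => if k = 0 then 0 else b ^ k := by
      ext k
      simp only [Multiset.map_cons, Multiset.sum_cons, map_sub, PowerSeries.coeff_mk]
      split_ifs <;> ring
    have h2 : (1 - PowerSeries.C b * PowerSeries.X) *
        (PowerSeries.mk fun k => if k = 0 then 0 else b ^ k) =
          PowerSeries.C b * PowerSeries.X := by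
      ext k
      rw [sub_mul, one_mul, mul_assoc, map_sub, PowerSeries.coeff_C_mul, PowerSeries.coeff_C_mul]
      rcases k with - | k
      · simp
      · rw [PowerSeries.coeff_succ_X_mul, PowerSeries.coeff_mk, PowerSeries.coeff_mk,
          PowerSeries.coeff_X]
        rcases k with - | k <;> simp [pow_succ, mul_comm]
    rw [h, Multiset.map_cons, Multiset.prod_cons, Derivation.leibniz, smul_eq_mul, smul_eq_mul]
    have h3 : PowerSeries.derivative K (1 - PowerSeries.C b * PowerSeries.X) =
        - PowerSeries.C b := by
      ext k
      rw [PowerSeries.coeff_derivative]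
      rcases k with - | k <;> simp [PowerSeries.coeff_C, PowerSeries.coeff_one]
    rw [h3]
    linear_combination (1 - PowerSeries.C b * PowerSeries.X) * ih +
      (s.map fun b => 1 - PowerSeries.C b * PowerSeries.X).prod * h2

/-- If the generating function of `A` is a polynomial, its logarithmic derivative is a sum of
geometric series. -/
lemma exists_multiset_eq_neg_sum_pow {K : Type*} [Field K] [IsAlgClosed K] {D : ℕ} {A Ψ : ℕ → K}
    (hA : A 0 = 1) (hD : ∀ k, D ≤ k → A k = 0)
    (h : ∀ k, k * A k = ∑ p ∈ Finset.HasAntidiagonal.antidiagonal k, Ψ p.1 * A p.2) :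
    ∃ s : Multiset K, Multiset.card s ≤ D ∧
      ∀ k, 1 ≤ k → Ψ k = -(s.map fun b => b ^ k).sum := by
  have hcoeff : ∀ k, (∑ i ∈ Finset.range D, C (A i) * X ^ i).coeff k = A k := by
    intro k
    simp only [finsetSum_coeff, coeff_C_mul, coeff_X_pow]
    by_cases hk : k < D
    · rw [Finset.sum_eq_single k] <;> simp +contextual [hk, eq_comm]
    · rw [hD k (by omega)]
      refine Finset.sum_eq_zero fun i hi => ?_
      rw [if_neg (by have := Finset.mem_range.1 hi; omega), mul_zero]
  obtain ⟨s, hs, hsL⟩ := exists_multiset_eq_prod ((hcoeff 0).trans hA)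
  refine ⟨s, hs.trans ?_, fun k hk => ?_⟩
  · exact natDegree_sum_le_of_forall_le _ _ fun i hi =>
      (natDegree_C_mul_X_pow_le _ _).trans (Finset.mem_range.1 hi).le
  · have h1 : PowerSeries.mk A = (s.map fun b => 1 - PowerSeries.C b * PowerSeries.X).prod := by
      have := congrArg (Polynomial.coeToPowerSeries.ringHom (R := K)) hsL
      rw [map_multiset_prod, Multiset.map_map] at this
      simp only [Function.comp_def, map_sub, map_one, map_mul,
        Polynomial.coeToPowerSeries.ringHom_apply, Polynomial.coe_C, Polynomial.coe_X] at this
      rw [← this]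
      ext k
      rw [PowerSeries.coeff_mk, Polynomial.coeff_coe, hcoeff]
    have h2 : PowerSeries.X * PowerSeries.derivative K (PowerSeries.mk A) =
        PowerSeries.mk Ψ * PowerSeries.mk A := by
      ext k
      rw [PowerSeries.coeff_mul k (PowerSeries.mk Ψ)]
      simp only [PowerSeries.coeff_mk]
      rw [← h]
      rcases k with - | k
      · simp
      · rw [PowerSeries.coeff_succ_X_mul, PowerSeries.coeff_derivative, PowerSeries.coeff_mk]
        push_cast
        ring
    have h3 := X_mul_derivative_prod s
    rw [← h1, h2] at h3
    have h4 : PowerSeries.mk A ≠ 0 := fun h => by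
      have := congrArg (PowerSeries.coeff 0) h
      simp [hA] at this
    have h5 := congrArg (PowerSeries.coeff k) (mul_right_cancel₀ h4 h3)
    simpa [show k ≠ 0 by omega] using h5

/-- A bound of the right order for a subsequence of the power sums bounds all of them. -/
lemma norm_sq_le_of_forall_norm_le {s : Multiset ℂ} {D : ℕ} {Q C : ℝ} {k₀ : ℕ} (hQ : 0 < Q)
    (hs : Multiset.card s ≤ D)
    (h : ∀ k ≥ k₀, ‖(s.map fun b => b ^ (2 * k)).sum‖ ≤ C * Q ^ k) (n : ℕ) :
    ‖(s.map fun b => b ^ n).sum‖ ^ 2 ≤ D ^ 2 * Q ^ n := by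
  have hb : ∀ b ∈ s, ‖b ^ n‖ ≤ √Q ^ n := by
    intro b hb
    have h1 : ‖b ^ 2‖ ≤ Q := by
      refine norm_le_of_forall_norm_powerSum_le (s := s.map fun b => b ^ 2) (C := C) (k₀ := k₀) hQ
        (fun k hk => ?_) (Multiset.mem_map_of_mem _ hb)
      rw [Multiset.map_map]
      simpa only [Function.comp_def, ← pow_mul] using h k hk
    rw [norm_pow] at h1 ⊢
    exact pow_le_pow_left₀ (norm_nonneg _) (Real.le_sqrt_of_sq_le h1) _
  have h2 : ‖(s.map fun b => b ^ n).sum‖ ≤ D * √Q ^ n := by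
    refine (norm_multiset_sum_le _).trans ?_
    rw [Multiset.map_map]
    refine (Multiset.sum_le_card_nsmul _ (√Q ^ n) fun x hx => ?_).trans ?_
    · obtain ⟨b, hbs, rfl⟩ := Multiset.mem_map.1 hx
      exact hb b hbs
    · rw [Multiset.card_map, nsmul_eq_mul]
      gcongr
  refine (pow_le_pow_left₀ (norm_nonneg _) h2 2).trans (le_of_eq ?_)
  rw [mul_pow, ← pow_mul, mul_comm n, pow_mul, Real.sq_sqrt hQ.le]

end PowerSums

section TopClass

open Polynomial

variable {F : Type*} [Field F]

/-- The class of a polynomial determined by its `D + 1` top coefficients. -/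
noncomputable def topClass (F : Type*) [Field F] (D : ℕ) :
    F[X] →* AdjoinRoot (X ^ (D + 1) : F[X]) where
  toFun f := AdjoinRoot.mk _ f.reverse
  map_one' := by rw [← C_1, reverse_C, C_1, map_one]
  map_mul' f g := by rw [reverse_mul_of_domain, map_mul]

lemma topClass_eq_iff {D : ℕ} {f g : F[X]} :
    topClass F D f = topClass F D g ↔ ∀ l ≤ D, f.reverse.coeff l = g.reverse.coeff l := by
  change AdjoinRoot.mk _ f.reverse = AdjoinRoot.mk _ g.reverse ↔ _
  rw [AdjoinRoot.mk_eq_mk, X_pow_dvd_iff]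
  simp only [coeff_sub, sub_eq_zero, Nat.lt_succ_iff]

lemma isUnit_topClass {D : ℕ} {f : F[X]} (hf : f.Monic) : IsUnit (topClass F D f) := by
  have h : IsCoprime f.reverse (X ^ (D + 1)) := by
    refine IsCoprime.pow_right (IsCoprime.symm ?_)
    rw [irreducible_X.coprime_iff_not_dvd, X_dvd_iff, coeff_zero_reverse, hf.leadingCoeff]
    exact one_ne_zero
  obtain ⟨a, b, hab⟩ := h
  refine IsUnit.of_mul_eq_one (AdjoinRoot.mk _ a) ?_
  have := congrArg (AdjoinRoot.mk (X ^ (D + 1) : F[X])) hab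
  rw [map_add, map_mul, map_mul, AdjoinRoot.mk_self, mul_zero, add_zero, map_one] at this
  rw [mul_comm]
  exact this

lemma topClass_mul_X_pow {D : ℕ} (f : F[X]) (k : ℕ) :
    topClass F D (f * X ^ k) = topClass F D f :=
  congrArg (AdjoinRoot.mk _) (reverse_mul_X_pow f k)

variable [Fintype F]

noncomputable instance (D : ℕ) : Fintype (AdjoinRoot (X ^ (D + 1) : F[X])) :=
  have : Module.Finite F (AdjoinRoot (X ^ (D + 1) : F[X])) := (monic_X_pow _).finite_adjoinRoot
  have := Module.finite_of_finite F (M := AdjoinRoot (X ^ (D + 1) : F[X]))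
  Fintype.ofFinite _

/-- The classes of monic polynomials. -/
noncomputable def topClasses (F : Type*) [Field F] [Fintype F] (D : ℕ) :
    Finset (AdjoinRoot (X ^ (D + 1) : F[X])) :=
  (monicFinset F D).image (topClass F D)

lemma topClass_mem_topClasses {D : ℕ} {f : F[X]} (hf : f.Monic) :
    topClass F D f ∈ topClasses F D := by
  have hmem : monicOfCoeffs D (fun i => f.reverse.coeff (D - i)) ∈ monicFinset F D :=
    Finset.mem_image_of_mem _ (Finset.mem_univ _)
  refine Finset.mem_image.2 ⟨_, hmem, topClass_eq_iff.2 fun l hl => ?_⟩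
  rw [coeff_reverse, (mem_monicFinset.1 hmem).2, revAt_le hl, monicOfCoeffs, coeff_add,
    coeff_sum_C_mul_X_pow, coeff_X_pow]
  rcases Nat.eq_zero_or_pos l with rfl | hl0
  · simp [coeff_zero_reverse, hf.leadingCoeff]
  · rw [dif_pos (by omega), if_neg (by omega), zero_add]
    congr 1
    simp only
    omega

lemma exists_mem_monicFinset_topClass_eq {D k : ℕ} (hk : D ≤ k)
    {w : AdjoinRoot (X ^ (D + 1) : F[X])} (hw : w ∈ topClasses F D) :
    ∃ f ∈ monicFinset F k, topClass F D f = w := by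
  obtain ⟨f, hf, rfl⟩ := Finset.mem_image.1 hw
  rw [mem_monicFinset] at hf
  refine ⟨f * X ^ (k - D), mem_monicFinset.2 ⟨hf.1.mul (monic_X_pow _), ?_⟩,
    topClass_mul_X_pow _ _⟩
  rw [hf.1.natDegree_mul (monic_X_pow _), hf.2, natDegree_X_pow]
  omega

/-- Short intervals are fibers of `topClass`. -/
lemma sum_interval_eq {M : Type*} [AddCommMonoid M] {D k l : ℕ} (hk : k = l + D) {f : F[X]}
    (hf : f ∈ monicFinset F k) (G : F[X] → M) :
    ∑ a : Fin l → F, G (f + ∑ j : Fin l, C (a j) * X ^ (j : ℕ)) =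
      ∑ g ∈ (monicFinset F k).filter fun g => topClass F D g = topClass F D f, G g := by
  obtain ⟨hfm, hfk⟩ := mem_monicFinset.1 hf
  refine Finset.sum_bij (fun a _ => f + ∑ j : Fin l, C (a j) * X ^ (j : ℕ)) ?_ ?_ ?_ fun _ _ => rfl
  · intro a _
    have hdeg : (∑ j : Fin l, C (a j) * X ^ (j : ℕ)).degree < f.degree := by
      refine (degree_sum_C_mul_X_pow_lt a).trans_le ?_
      rw [degree_eq_natDegree hfm.ne_zero, hfk]
      exact_mod_cast (by omega : l ≤ k)
    have hnat : (f + ∑ j : Fin l, C (a j) * X ^ (j : ℕ)).natDegree = k := by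
      rw [natDegree_add_eq_left_of_degree_lt hdeg, hfk]
    rw [Finset.mem_filter, mem_monicFinset, topClass_eq_iff]
    refine ⟨⟨hfm.add_of_left hdeg, hnat⟩, fun i hi => ?_⟩
    rw [coeff_reverse, coeff_reverse, hnat, hfk, revAt_le (by omega), coeff_add,
      coeff_sum_C_mul_X_pow, dif_neg (by omega), add_zero]
  · intro a _ b _ hab
    ext j
    have := congrArg (fun f => f.coeff (j : ℕ)) (add_left_cancel hab)
    simpa only [coeff_sum_C_mul_X_pow, dif_pos j.2] using this
  · intro g hg
    rw [Finset.mem_filter, mem_monicFinset, topClass_eq_iff] at hg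
    obtain ⟨⟨hgm, hgk⟩, hg⟩ := hg
    refine ⟨fun j => g.coeff j - f.coeff j, Finset.mem_univ _, ?_⟩
    ext i
    rw [coeff_add, coeff_sum_C_mul_X_pow]
    split_ifs with hi
    · ring
    · rw [add_zero]
      by_cases hik : i ≤ k
      · have := hg (k - i) (by omega)
        rw [coeff_reverse, coeff_reverse, hgk, hfk, revAt_le (by omega)] at this
        rw [show k - (k - i) = i by omega] at this
        exact this.symm
      · rw [coeff_eq_zero_of_natDegree_lt (by omega), coeff_eq_zero_of_natDegree_lt (by omega)]

lemma card_fiber_topClass {D k : ℕ} (hk : D ≤ k) {w : AdjoinRoot (X ^ (D + 1) : F[X])}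
    (hw : w ∈ topClasses F D) :
    ((monicFinset F k).filter fun g => topClass F D g = w).card = Fintype.card F ^ (k - D) := by
  obtain ⟨f, hf, rfl⟩ := exists_mem_monicFinset_topClass_eq hk hw
  rw [Finset.card_eq_sum_ones, ← sum_interval_eq (l := k - D) (by omega) hf fun _ => 1]
  simp

lemma sum_monicFinset_eq_sum_topClasses {M : Type*} [AddCommMonoid M] (D k : ℕ) (G : F[X] → M) :
    ∑ f ∈ monicFinset F k, G f = ∑ w ∈ topClasses F D,
      ∑ f ∈ (monicFinset F k).filter fun g => topClass F D g = w, G f :=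
  (Finset.sum_fiberwise_of_maps_to
    (fun _ hf => topClass_mem_topClasses (mem_monicFinset.1 hf).1) _).symm

lemma card_topClasses (D : ℕ) : (topClasses F D).card = Fintype.card F ^ D := by
  have h := sum_monicFinset_eq_sum_topClasses D D (fun _ : F[X] => 1)
  simp only [← Finset.card_eq_sum_ones] at h
  rw [card_monicFinset, Finset.sum_congr rfl fun w hw => card_fiber_topClass le_rfl hw] at h
  simpa using h.symm

lemma sum_topClasses_eq_zero {D : ℕ} {χ : MulChar (AdjoinRoot (X ^ (D + 1) : F[X])) ℂ}
    {w₀ : AdjoinRoot (X ^ (D + 1) : F[X])} (hw₀ : w₀ ∈ topClasses F D) (hχ : χ w₀ ≠ 1) :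
    ∑ w ∈ topClasses F D, χ w = 0 := by
  obtain ⟨f₀, hf₀, rfl⟩ := Finset.mem_image.1 hw₀
  have hm := (mem_monicFinset.1 hf₀).1
  refine eq_zero_of_mul_eq_self_left hχ ?_
  rw [Finset.mul_sum]
  have hinj : Function.Injective (topClass F D f₀ * ·) := (isUnit_topClass hm).mul_right_injective
  have himg : (topClasses F D).image (topClass F D f₀ * ·) = topClasses F D := by
    refine Finset.eq_of_subset_of_card_le ?_ (Finset.card_image_of_injective _ hinj).ge
    intro w hw
    obtain ⟨v, hv, rfl⟩ := Finset.mem_image.1 hw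
    obtain ⟨f, hf, rfl⟩ := Finset.mem_image.1 hv
    rw [← map_mul]
    exact topClass_mem_topClasses (hm.mul (mem_monicFinset.1 hf).1)
  conv_rhs => rw [← himg, Finset.sum_image fun _ _ _ _ h => hinj h]
  simp only [map_mul]

/-- The sum of `Λ` over the monic polynomials of degree `k` in a given class. -/
noncomputable def mangoldtSum {D : ℕ} (k : ℕ) (w : AdjoinRoot (X ^ (D + 1) : F[X])) : ℕ :=
  ∑ f ∈ (monicFinset F k).filter fun g => topClass F D g = w, polyVonMangoldt f

lemma sum_mangoldtSum {D k : ℕ} (hk : 1 ≤ k) :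
    ∑ w ∈ topClasses F D, mangoldtSum k w = Fintype.card F ^ k := by
  rw [← sum_polyVonMangoldt hk]
  exact (sum_monicFinset_eq_sum_topClasses D k _).symm

lemma mangoldtSum_le {D K : ℕ} (hDK : D ≤ K) (hK : D ^ 2 + 2 ≤ Fintype.card F ^ K)
    (w : AdjoinRoot (X ^ (D + 1) : F[X])) (hw : w ∈ topClasses F D) :
    mangoldtSum (2 * K) w ≤
      Fintype.card F ^ (2 * K - D) + (2 * D ^ 2 + 3) * Fintype.card F ^ K := by
  obtain ⟨p, -, rfl⟩ := Finset.mem_image.1 hw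
  set T := ((monicFinset F (2 * K)).filter fun g => topClass F D g = topClass F D p).filter
    fun f => polyVonMangoldt f ≠ 0 with hT
  have hex : ∀ f ∈ T, ∃ P : F[X], P.Monic ∧ Irreducible P ∧ ∃ k, 1 ≤ k ∧ f = P ^ k := by
    intro f hf
    simp only [hT, Finset.mem_filter, mem_monicFinset] at hf
    exact exists_eq_pow_of_polyVonMangoldt_ne_zero hf.1.1.1 hf.2
  choose! P hPm hPi j hj hfj using hex
  have hdeg : ∀ f ∈ T, (P f).natDegree * j f = 2 * K := by
    intro f hf
    rw [mul_comm, ← natDegree_pow, ← hfj f hf]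
    simp only [hT, Finset.mem_filter, mem_monicFinset] at hf
    exact hf.1.1.2
  have hinj : Set.InjOn P T := by
    intro f hf g hg hfg
    have h := (hdeg f hf).trans (hdeg g hg).symm
    rw [hfg] at h
    have := Nat.eq_of_mul_eq_mul_left (hPi g hg).natDegree_pos h
    rw [hfj f hf, hfj g hg, this, hfg]
  refine le_trans (le_of_eq ?_) (sum_natDegree_le hDK hK p.reverse (T.image P) ?_)
  · rw [Finset.sum_image hinj, mangoldtSum, ← Finset.sum_filter_ne_zero]
    refine Finset.sum_congr rfl fun f hf => ?_
    conv_lhs => rw [hfj f hf]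
    exact polyVonMangoldt_pow (hPi f hf) (hj f hf)
  · intro Q hQ
    obtain ⟨f, hf, rfl⟩ := Finset.mem_image.1 hQ
    refine ⟨hPm f hf, hPi f hf, j f, hdeg f hf, ?_⟩
    rw [← hfj f hf]
    simp only [hT, Finset.mem_filter, topClass_eq_iff] at hf
    exact hf.1.2

end TopClass

lemma MulChar.norm_apply_le_one {A : Type*} [CommRing A] [Finite A] (χ : MulChar A ℂ) (a : A) :
    ‖χ a‖ ≤ 1 := by
  by_cases ha : IsUnit a
  · have h : χ a ^ Nat.card Aˣ = 1 := by
      obtain ⟨u, rfl⟩ := ha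
      rw [← map_pow, ← Units.val_pow_eq_pow_val, pow_card_eq_one', Units.val_one, map_one]
    exact (Complex.norm_eq_one_of_pow_eq_one h Nat.card_pos.ne').le
  · simp [χ.map_nonunit ha]

lemma MulChar.sum_apply_eq_zero {A : Type*} [CommRing A] [Finite A] [Fintype (MulChar A ℂ)] {a : A}
    (ha : a ≠ 1) : ∑ χ : MulChar A ℂ, χ a = 0 := by
  obtain ⟨χ, hχ⟩ := MulChar.exists_apply_ne_one_of_hasEnoughRootsOfUnity A ℂ ha
  refine eq_zero_of_mul_eq_self_left hχ ?_
  simp only [Finset.mul_sum, ← MulChar.mul_apply]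
  exact Fintype.sum_bijective _ (Group.mulLeft_bijective χ) _ _ fun χ' => rfl

/-- A consequence of Parseval's identity on the unit group of a finite ring. -/
lemma sum_sq_le_of_forall_norm_sum_mulChar_le {A : Type*} [CommRing A] [Fintype A] {W : Finset A}
    (hW : ∀ a ∈ W, IsUnit a) (g : A → ℝ) {M : ℝ}
    (h : ∀ χ : MulChar A ℂ, ‖∑ a ∈ W, (g a : ℂ) * χ a‖ ^ 2 ≤ M) : ∑ a ∈ W, g a ^ 2 ≤ M := by
  have : Fintype (MulChar A ℂ) := Fintype.ofFinite _
  have horth : ∀ a ∈ W, ∀ b ∈ W, ∑ χ : MulChar A ℂ, χ a * χ⁻¹ b =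
      if a = b then (Fintype.card (MulChar A ℂ) : ℂ) else 0 := by
    intro a ha b hb
    simp only [MulChar.inv_apply, ← map_mul]
    split_ifs with hab
    · rw [hab, Ring.mul_inverse_cancel _ (hW b hb)]
      simp
    · refine MulChar.sum_apply_eq_zero fun h1 => hab ?_
      have := congrArg (· * b) h1
      simpa [mul_assoc, Ring.inverse_mul_cancel _ (hW b hb)] using this
  have hkey : ∑ χ : MulChar A ℂ, ((‖∑ a ∈ W, (g a : ℂ) * χ a‖ ^ 2 : ℝ) : ℂ) =
      Fintype.card (MulChar A ℂ) * ∑ a ∈ W, (g a : ℂ) ^ 2 := by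
    have h1 : ∀ χ : MulChar A ℂ, ((‖∑ a ∈ W, (g a : ℂ) * χ a‖ ^ 2 : ℝ) : ℂ) =
        ∑ a ∈ W, ∑ b ∈ W, (g a * g b : ℂ) * (χ a * χ⁻¹ b) := by
      intro χ
      rw [Complex.ofReal_pow, ← Complex.mul_conj', map_sum, Finset.sum_mul_sum]
      refine Finset.sum_congr rfl fun a _ => Finset.sum_congr rfl fun b _ => ?_
      rw [map_mul, Complex.conj_ofReal, ← MulChar.star_apply' χ b]
      simp only [RCLike.star_def]
      ring
    rw [Finset.sum_congr rfl fun χ _ => h1 χ, Finset.sum_comm, Finset.mul_sum]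
    refine Finset.sum_congr rfl fun a ha => ?_
    rw [Finset.sum_comm]
    simp only [← Finset.mul_sum]
    rw [Finset.sum_congr rfl fun b hb => by rw [horth a ha b hb]]
    simp only [mul_ite, mul_zero, Finset.sum_ite_eq, if_pos ha]
    ring
  have hle : (Fintype.card (MulChar A ℂ) : ℝ) * ∑ a ∈ W, g a ^ 2 ≤
      Fintype.card (MulChar A ℂ) * M := by
    have h2 : ∑ χ : MulChar A ℂ, ‖∑ a ∈ W, (g a : ℂ) * χ a‖ ^ 2 =
        Fintype.card (MulChar A ℂ) * ∑ a ∈ W, g a ^ 2 := by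
      exact_mod_cast hkey
    rw [← h2]
    refine (Finset.sum_le_card_nsmul _ _ M fun χ _ => h χ).trans (le_of_eq ?_)
    simp
  exact le_of_mul_le_mul_left hle (by exact_mod_cast Fintype.card_pos)

lemma abs_sub_le_of_forall_le_add {ι : Type*} {W : Finset ι} {x : ι → ℝ} {a E : ℝ}
    (hsum : ∑ w ∈ W, x w = W.card * a) (hE : 0 ≤ E) (hle : ∀ w ∈ W, x w ≤ a + E) {w : ι}
    (hw : w ∈ W) : |x w - a| ≤ W.card * E := by
  have h1 : ∑ v ∈ W.erase w, (x v - a) + (x w - a) = 0 := by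
    rw [Finset.sum_erase_add _ _ hw, Finset.sum_sub_distrib, hsum]
    simp
  have h2 : ∑ v ∈ W.erase w, (x v - a) ≤ W.card * E := by
    refine (Finset.sum_le_card_nsmul _ _ E fun v hv => ?_).trans ?_
    · linarith [hle v (Finset.mem_of_mem_erase hv)]
    · rw [nsmul_eq_mul]
      exact mul_le_mul_of_nonneg_right (by exact_mod_cast Finset.card_erase_le) hE
  have h3 : (1 : ℝ) ≤ W.card := by exact_mod_cast Finset.card_pos.2 ⟨w, hw⟩
  rw [abs_le]
  constructor
  · linarith
  · nlinarith [hle w hw]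

section SecondMoment

open Polynomial

variable {F : Type*} [Field F] [Fintype F]

/-- The Riemann hypothesis for the characters of `topClass`. -/
lemma norm_sum_mangoldtSum_mul_sq_le {D : ℕ} (χ : MulChar (AdjoinRoot (X ^ (D + 1) : F[X])) ℂ)
    {w₀ : AdjoinRoot (X ^ (D + 1) : F[X])} (hw₀ : w₀ ∈ topClasses F D) (hχ : χ w₀ ≠ 1) {n : ℕ}
    (hn : 1 ≤ n) :
    ‖∑ w ∈ topClasses F D, (mangoldtSum n w : ℂ) * χ w‖ ^ 2 ≤
      D ^ 2 * (Fintype.card F : ℝ) ^ n := by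
  have hq : 1 < Fintype.card F := Fintype.one_lt_card
  have hq0 : (0 : ℝ) < Fintype.card F := by exact_mod_cast hq.le
  have hzero := sum_topClasses_eq_zero hw₀ hχ
  let ψ : F[X] →* ℂ := χ.toMonoidHom.comp (topClass F D)
  have hψ : ∀ f, ψ f = χ (topClass F D f) := fun _ => rfl
  have hΨ : ∀ k, ∑ f ∈ monicFinset F k, polyVonMangoldt f * ψ f =
      ∑ w ∈ topClasses F D, (mangoldtSum k w : ℂ) * χ w := by
    intro k
    rw [sum_monicFinset_eq_sum_topClasses D]
    refine Finset.sum_congr rfl fun w _ => ?_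
    rw [mangoldtSum, Nat.cast_sum, Finset.sum_mul]
    refine Finset.sum_congr rfl fun f hf => ?_
    rw [hψ, (Finset.mem_filter.1 hf).2]
  have hA : ∀ k, D ≤ k → ∑ f ∈ monicFinset F k, ψ f = 0 := by
    intro k hk
    rw [sum_monicFinset_eq_sum_topClasses D]
    have : ∀ w ∈ topClasses F D, ∑ f ∈ (monicFinset F k).filter fun g => topClass F D g = w, ψ f =
        (Fintype.card F : ℂ) ^ (k - D) * χ w := by
      intro w hw
      rw [Finset.sum_congr rfl fun f hf => by rw [hψ, (Finset.mem_filter.1 hf).2],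
        Finset.sum_const, card_fiber_topClass hk hw, nsmul_eq_mul]
      push_cast
      rfl
    rw [Finset.sum_congr rfl this, ← Finset.mul_sum, hzero, mul_zero]
  obtain ⟨s, hs, hpow⟩ := exists_multiset_eq_neg_sum_pow (D := D)
    (A := fun k => ∑ f ∈ monicFinset F k, ψ f)
    (Ψ := fun k => ∑ f ∈ monicFinset F k, polyVonMangoldt f * ψ f)
    (by simp [monicFinset_zero]) hA (mul_sum_eq_sum_antidiagonal ψ)
  rw [← hΨ, hpow n hn, norm_neg]
  refine norm_sq_le_of_forall_norm_le
    (C := (Fintype.card F : ℝ) ^ D * ((Fintype.card F : ℝ) ^ D * (2 * D ^ 2 + 3)))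
    (k₀ := D ^ 2 + D + 2) hq0 hs (fun K hK => ?_) n
  rw [← norm_neg, ← hpow (2 * K) (by omega), hΨ]
  set E : ℝ := (2 * D ^ 2 + 3) * (Fintype.card F : ℝ) ^ K with hE
  have hcard : ((topClasses F D).card : ℝ) = (Fintype.card F : ℝ) ^ D := by
    rw [card_topClasses]; push_cast; rfl
  have hbound : ∀ w ∈ topClasses F D,
      |(mangoldtSum (2 * K) w : ℝ) - (Fintype.card F : ℝ) ^ (2 * K - D)| ≤
        (Fintype.card F : ℝ) ^ D * E := by
    intro w hw
    rw [← hcard]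
    refine abs_sub_le_of_forall_le_add (x := fun w => (mangoldtSum (2 * K) w : ℝ)) ?_
      (by positivity) (fun v hv => ?_) hw
    · rw [hcard, ← pow_add, show D + (2 * K - D) = 2 * K by omega]
      exact_mod_cast sum_mangoldtSum (F := F) (D := D) (k := 2 * K) (by omega)
    · have := mangoldtSum_le (by omega : D ≤ K)
        ((by omega : D ^ 2 + 2 ≤ K).trans (Nat.lt_pow_self hq).le) v hv
      rw [hE]
      exact_mod_cast this
  have hshift : ∑ w ∈ topClasses F D, (mangoldtSum (2 * K) w : ℂ) * χ w =
      ∑ w ∈ topClasses F D,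
        (((mangoldtSum (2 * K) w : ℝ) - (Fintype.card F : ℝ) ^ (2 * K - D) : ℝ) : ℂ) * χ w := by
    push_cast
    simp only [sub_mul, Finset.sum_sub_distrib, ← Finset.mul_sum, hzero, mul_zero, sub_zero]
  rw [hshift]
  refine (norm_sum_le_of_le (n := fun _ => (Fintype.card F : ℝ) ^ D * E) _ fun w hw => ?_).trans
    (le_of_eq ?_)
  · rw [norm_mul, Complex.norm_real, Real.norm_eq_abs, ← mul_one ((Fintype.card F : ℝ) ^ D * E)]
    exact mul_le_mul (hbound w hw) (χ.norm_apply_le_one w) (norm_nonneg _) (by positivity)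
  · rw [Finset.sum_const, nsmul_eq_mul, hcard, hE]
    ring

lemma sum_topClasses_sub_sq_le {D n : ℕ} (hn : 1 ≤ n) (hD : D ≤ n) :
    ∑ w ∈ topClasses F D, ((mangoldtSum n w : ℝ) - (Fintype.card F : ℝ) ^ (n - D)) ^ 2 ≤
      D ^ 2 * (Fintype.card F : ℝ) ^ n := by
  have hunit : ∀ w ∈ topClasses F D, IsUnit w := by
    intro w hw
    obtain ⟨f, hf, rfl⟩ := Finset.mem_image.1 hw
    exact isUnit_topClass (mem_monicFinset.1 hf).1
  refine sum_sq_le_of_forall_norm_sum_mulChar_le hunit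
    (fun w => (mangoldtSum n w : ℝ) - (Fintype.card F : ℝ) ^ (n - D)) fun χ => ?_
  push_cast
  simp only [sub_mul, Finset.sum_sub_distrib, ← Finset.mul_sum]
  by_cases h : ∀ w ∈ topClasses F D, χ w = 1
  · have h1 : ∑ w ∈ topClasses F D, (mangoldtSum n w : ℂ) * χ w =
        (Fintype.card F : ℂ) ^ n := by
      rw [Finset.sum_congr rfl fun w hw => by rw [h w hw, mul_one]]
      exact_mod_cast sum_mangoldtSum (F := F) (D := D) hn
    have h2 : ∑ w ∈ topClasses F D, χ w = (Fintype.card F : ℂ) ^ D := by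
      rw [Finset.sum_congr rfl h, Finset.sum_const, card_topClasses]
      simp
    rw [h1, h2, ← pow_add, show n - D + D = n by omega, sub_self, norm_zero, zero_pow two_ne_zero]
    positivity
  · push Not at h
    obtain ⟨w₀, hw₀, hχ⟩ := h
    rw [sum_topClasses_eq_zero hw₀ hχ, mul_zero, sub_zero]
    exact norm_sum_mangoldtSum_mul_sq_le χ hw₀ hχ hn

/-- The variance of `Λ` in short intervals. -/
lemma sum_interval_sq_le {n l D : ℕ} (hn : 1 ≤ n) (hl : n = l + D) :
    ∑ f ∈ monicFinset F n, (∑ a : Fin l → F,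
      ((polyVonMangoldt (f + ∑ j : Fin l, C (a j) * X ^ (j : ℕ)) : ℝ) - 1)) ^ 2 ≤
      D ^ 2 * (Fintype.card F : ℝ) ^ l * (Fintype.card F : ℝ) ^ n := by
  have hS : ∀ f ∈ monicFinset F n, ∑ a : Fin l → F,
      ((polyVonMangoldt (f + ∑ j : Fin l, C (a j) * X ^ (j : ℕ)) : ℝ) - 1) =
        (mangoldtSum n (topClass F D f) : ℝ) - (Fintype.card F : ℝ) ^ (n - D) := by
    intro f hf
    rw [sum_interval_eq hl hf fun g => (polyVonMangoldt g : ℝ) - 1, Finset.sum_sub_distrib,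
      Finset.sum_const, card_fiber_topClass (by omega)
        (topClass_mem_topClasses (mem_monicFinset.1 hf).1), mangoldtSum]
    simp
  rw [Finset.sum_congr rfl fun f hf => by rw [hS f hf], sum_monicFinset_eq_sum_topClasses D]
  have hfib : ∀ w ∈ topClasses F D,
      ∑ f ∈ (monicFinset F n).filter fun g => topClass F D g = w,
        ((mangoldtSum n (topClass F D f) : ℝ) - (Fintype.card F : ℝ) ^ (n - D)) ^ 2 =
      (Fintype.card F : ℝ) ^ l *
        ((mangoldtSum n w : ℝ) - (Fintype.card F : ℝ) ^ (n - D)) ^ 2 := by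
    intro w hw
    rw [Finset.sum_congr rfl fun f hf => by rw [(Finset.mem_filter.1 hf).2], Finset.sum_const,
      card_fiber_topClass (by omega) hw, nsmul_eq_mul, show n - D = l by omega]
    push_cast
    rfl
  rw [Finset.sum_congr rfl hfib, ← Finset.mul_sum, mul_comm ((D : ℝ) ^ 2), mul_assoc]
  exact mul_le_mul_of_nonneg_left (sum_topClasses_sub_sq_le hn (by omega)) (by positivity)

lemma abs_sum_interval_le {n l : ℕ} (hn : 1 ≤ n) (hl : l ≤ n) {f : F[X]}
    (hf : f ∈ monicFinset F n) :
    |∑ a : Fin l → F, ((polyVonMangoldt (f + ∑ j : Fin l, C (a j) * X ^ (j : ℕ)) : ℝ) - 1)| ≤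
      n * (Fintype.card F : ℝ) ^ l := by
  obtain ⟨hfm, hfn⟩ := mem_monicFinset.1 hf
  refine (Finset.abs_sum_le_sum_abs _ _).trans
    ((Finset.sum_le_card_nsmul _ _ (n : ℝ) fun a _ => ?_).trans (le_of_eq ?_))
  · have h1 : polyVonMangoldt (f + ∑ j : Fin l, C (a j) * X ^ (j : ℕ)) ≤ n := by
      refine (polyVonMangoldt_le_natDegree _).trans (natDegree_add_le_of_degree_le hfn.le ?_)
      exact (natDegree_le_of_degree_le (degree_sum_C_mul_X_pow_lt a).le).trans hl
    have h2 : (polyVonMangoldt (f + ∑ j : Fin l, C (a j) * X ^ (j : ℕ)) : ℝ) ≤ n := by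
      exact_mod_cast h1
    have h3 : (1 : ℝ) ≤ n := by exact_mod_cast hn
    rw [abs_le]
    constructor <;> linarith [Nat.cast_nonneg (α := ℝ)
      (polyVonMangoldt (f + ∑ j : Fin l, C (a j) * X ^ (j : ℕ)))]
  · simp [mul_comm]

end SecondMoment

/-- Fix `m ≥ 2`, `n ≥ 4`, `1 ≤ h ≤ n - 3`. There is a `C > 0` such that
for every finite field `F` with `q` elements (of characteristic `> n` when `m > 2`),
`|q⁻ⁿ ∑_{f ∈ M_n(F)} (∑_{deg g ≤ h} Λ(f + g) - 1))^m| ≤ C q^{(h+1)(m-1)}`. -/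
theorem moments_polyVonMangoldt_sub_one (m n h : ℕ) (hm : 2 ≤ m) (hn : 4 ≤ n) (hh1 : 1 ≤ h)
    (hh2 : h ≤ n - 3) :
    ∃ C : ℝ, 0 < C ∧ ∀ (F : Type) [Field F] [Fintype F], (2 < m → n < ringChar F) →
      |(1 / (Fintype.card F : ℝ) ^ n) *
          (∑ co : Fin n → F, (∑ a : Fin (h + 1) → F,
            ((polyVonMangoldt (monicOfCoeffs n co +
              ∑ j : Fin (h + 1), Polynomial.C (a j) * Polynomial.X ^ (j : ℕ)) : ℝ) - 1)) ^ m)| ≤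
      C * (Fintype.card F : ℝ) ^ ((h + 1) * (m - 1)) := by
  obtain ⟨m, rfl⟩ := Nat.exists_eq_add_of_le' hm
  obtain ⟨D, hD⟩ : ∃ D, n = (h + 1) + D := ⟨n - (h + 1), by omega⟩
  have hn0 : (0 : ℝ) < n := by exact_mod_cast (by omega : 0 < n)
  have hD0 : (0 : ℝ) < D := by exact_mod_cast (by omega : 0 < D)
  refine ⟨(n : ℝ) ^ m * D ^ 2, by positivity, fun F _ _ _ => ?_⟩
  have hq0 : (0 : ℝ) < Fintype.card F := by exact_mod_cast Fintype.card_pos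
  rw [← sum_monicFinset n fun f => (∑ a : Fin (h + 1) → F, ((polyVonMangoldt (f +
    ∑ j : Fin (h + 1), Polynomial.C (a j) * Polynomial.X ^ (j : ℕ)) : ℝ) - 1)) ^ (m + 2),
    abs_mul, abs_of_pos (by positivity), div_mul_eq_mul_div, one_mul, div_le_iff₀ (by positivity)]
  calc _ ≤ ∑ f ∈ monicFinset F n, (n * (Fintype.card F : ℝ) ^ (h + 1)) ^ m *
        (∑ a : Fin (h + 1) → F, ((polyVonMangoldt (f +
          ∑ j : Fin (h + 1), Polynomial.C (a j) * Polynomial.X ^ (j : ℕ)) : ℝ) - 1)) ^ 2 := by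
        refine (Finset.abs_sum_le_sum_abs _ _).trans (Finset.sum_le_sum fun f hf => ?_)
        rw [pow_add, abs_mul, abs_sq, abs_pow]
        gcongr
        exact abs_sum_interval_le (by omega) (by omega) hf
    _ ≤ (n * (Fintype.card F : ℝ) ^ (h + 1)) ^ m *
        (D ^ 2 * (Fintype.card F : ℝ) ^ (h + 1) * (Fintype.card F : ℝ) ^ n) := by
        rw [← Finset.mul_sum]
        gcongr
        exact sum_interval_sq_le (by omega) hD
    _ = _ := by
        rw [show m + 2 - 1 = m + 1 by omega, pow_mul]
        ring
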